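/- Let 0<q<1 be real, let h̃1,h̃2,l̃1,l̃2,α̃1,α̃2,β̃,μ0,α1 be real numbers and t1,t2 nonzero complex numbers. Set χ = (h̃1+h̃2−l̃1−l̃2+α̃1−α̃2−β̃)/2, ν = μ0+α1−α̃2, μ = μ0+χ+1, β = −β̃−χ, α2 = α1+α̃1−α̃2−χ, l_i = h̃_i+μ0 and h_i = l̃_i+μ0+χ for i=1,2, and define Φ(x,s) = x^{−α1} s^{1+χ−α̃1} P¹_{μ,μ0}(x,s). Then for all nonzero complex x,s with x ∉ {q^{μ0+n}s : n ∈ ℤ}, applying A⟨4⟩(x; h1,h2,l1,l2,α1,α2,β) to Φ in the variable x gives q^{ν} times the result of applying A⟨4⟩(s; h̃1,h̃2,l̃1,l̃2,α̃1,α̃2,β̃) to Φ in the variable s. -/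

import Mathlib

open Filter Topology

/-- The infinite q-Pochhammer symbol `(a;q)_∞ = ∏_{j=0}^∞ (1 - q^j a)`. -/
noncomputable def qPochInf (q : ℝ) (a : ℂ) : ℂ := ∏' j : ℕ, (1 - (q : ℂ) ^ j * a)

/-- `q^r` for a real exponent `r`, using the principal branch of the complex power. -/
noncomputable def qpow (q : ℝ) (r : ℝ) : ℂ := (q : ℂ) ^ (r : ℂ)

/-- The fourth degenerate Ruijsenaars–van Diejen operator `A⟨4⟩` applied to `g` at `x`. -/
noncomputable def A4 (q : ℝ) (t1 t2 : ℂ) (h1 h2 l1 l2 a1 a2 b : ℝ) (g : ℂ → ℂ) (x : ℂ) : ℂ :=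
  x⁻¹ * (x - qpow q (h1 + 1/2) * t1) * (x - qpow q (h2 + 1/2) * t2) * g (x / (q : ℂ))
    + qpow q (a1 + a2) * x⁻¹ * (x - qpow q (l1 - 1/2) * t1) * (x - qpow q (l2 - 1/2) * t2) *
        g ((q : ℂ) * x)
    - ((qpow q a1 + qpow q a2) * x
        + qpow q ((h1 + h2 + l1 + l2 + a1 + a2) / 2) * (qpow q (b / 2) + qpow q (-(b / 2))) *
            t1 * t2 * x⁻¹) * g x

/-- `P¹_{μ,μ0}(x,s) = (q^μ s/x;q)_∞ / (q^{μ0} s/x;q)_∞`. -/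
noncomputable def P1 (q μ μ0 : ℝ) (x s : ℂ) : ℂ :=
  qPochInf q (qpow q μ * s / x) / qPochInf q (qpow q μ0 * s / x)

theorem qPochInf_eq_one_sub_mul {q : ℝ} (hq0 : 0 < q) (hq1 : q < 1) (a : ℂ) :
    qPochInf q a = (1 - a) * qPochInf q (q * a) := by
  have hsum : Summable fun j : ℕ => ‖-((q : ℂ) ^ (j + 1) * a)‖ := by
    have h := (summable_geometric_of_lt_one hq0.le hq1).mul_right (q * ‖a‖)
    refine h.congr fun j => ?_
    simp only [norm_neg, norm_mul, norm_pow, Complex.norm_real, Real.norm_of_nonneg hq0.le]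
    ring
  have hmul : Multipliable fun j : ℕ => 1 - (q : ℂ) ^ (j + 1) * a := by
    simpa [sub_eq_add_neg] using multipliable_one_add_of_summable hsum
  have h := tprod_eq_zero_mul' (f := fun j : ℕ => 1 - (q : ℂ) ^ j * a) hmul
  rw [pow_zero, one_mul] at h
  rw [qPochInf, qPochInf, h]
  congr 2
  funext j
  ring

theorem qpow_ne_zero {q : ℝ} (hq0 : 0 < q) (r : ℝ) : qpow q r ≠ 0 := by
  simp [qpow, Complex.cpow_eq_zero_iff, hq0.ne']

theorem qpow_add {q : ℝ} (hq0 : 0 < q) (r r' : ℝ) : qpow q (r + r') = qpow q r * qpow q r' := by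
  simp only [qpow, Complex.ofReal_add]
  exact Complex.cpow_add _ _ (by exact_mod_cast hq0.ne')

theorem qpow_neg (q r : ℝ) : qpow q (-r) = (qpow q r)⁻¹ := by
  simp only [qpow, Complex.ofReal_neg, Complex.cpow_neg]

theorem qpow_sub {q : ℝ} (hq0 : 0 < q) (r r' : ℝ) : qpow q (r - r') = qpow q r / qpow q r' := by
  rw [sub_eq_add_neg, qpow_add hq0, qpow_neg, div_eq_mul_inv]

theorem qpow_one (q : ℝ) : qpow q 1 = q := by simp [qpow]

theorem qpow_half_sq {q : ℝ} (hq0 : 0 < q) : qpow q (1 / 2) ^ 2 = q := by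
  rw [sq, ← qpow_add hq0, add_halves, qpow_one]

theorem mul_cpow_qpow {q : ℝ} (hq0 : 0 < q) {x : ℂ} (hx : x ≠ 0) (r : ℝ) :
    ((q : ℂ) * x) ^ (r : ℂ) = qpow q r * x ^ (r : ℂ) := by
  have hq : (q : ℂ) ≠ 0 := by exact_mod_cast hq0.ne'
  rw [qpow, Complex.cpow_def_of_ne_zero (mul_ne_zero hq hx), Complex.cpow_def_of_ne_zero hq,
    Complex.cpow_def_of_ne_zero hx, Complex.log_ofReal_mul hq0 hx, Complex.ofReal_log hq0.le,
    add_mul, Complex.exp_add]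

theorem div_cpow_qpow {q : ℝ} (hq0 : 0 < q) {x : ℂ} (hx : x ≠ 0) (r : ℝ) :
    (x / (q : ℂ)) ^ (r : ℂ) = x ^ (r : ℂ) / qpow q r := by
  have hq : (q : ℂ) ≠ 0 := by exact_mod_cast hq0.ne'
  rw [eq_div_iff (qpow_ne_zero hq0 r), mul_comm, ← mul_cpow_qpow hq0 (div_ne_zero hx hq),
    mul_div_cancel₀ _ hq]

theorem stmt0 (q : ℝ) (hq0 : 0 < q) (hq1 : q < 1)
    (th1 th2 tl1 tl2 ta1 ta2 tb μ0 a1 : ℝ) (t1 t2 : ℂ) (ht1 : t1 ≠ 0) (ht2 : t2 ≠ 0)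
    (χ ν μ b a2 l1 l2 h1 h2 : ℝ)
    (hχ : χ = (th1 + th2 - tl1 - tl2 + ta1 - ta2 - tb) / 2)
    (hν : ν = μ0 + a1 - ta2)
    (hμ : μ = μ0 + χ + 1)
    (hb : b = -tb - χ)
    (ha2 : a2 = a1 + ta1 - ta2 - χ)
    (hl1 : l1 = th1 + μ0) (hl2 : l2 = th2 + μ0)
    (hh1 : h1 = tl1 + μ0 + χ) (hh2 : h2 = tl2 + μ0 + χ)
    (Φ : ℂ → ℂ → ℂ)
    (hΦ : ∀ x s : ℂ, Φ x s = x ^ ((-a1 : ℝ) : ℂ) * s ^ ((1 + χ - ta1 : ℝ) : ℂ) * P1 q μ μ0 x s)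
    (x s : ℂ) (hx : x ≠ 0) (hs : s ≠ 0)
    (hres : ∀ n : ℤ, x ≠ qpow q (μ0 + n) * s) :
    A4 q t1 t2 h1 h2 l1 l2 a1 a2 b (fun y => Φ y s) x
      = qpow q ν * A4 q t1 t2 th1 th2 tl1 tl2 ta1 ta2 tb (fun u => Φ x u) s := by
  have hq : (q : ℂ) ≠ 0 := by exact_mod_cast hq0.ne'
  have hden : ∀ n : ℤ, 1 - qpow q (μ0 + n) * (s / x) ≠ 0 := by
    intro n h
    apply hres n
    field_simp at h
    linear_combination h
  have hden0 : 1 - qpow q μ0 * (s / x) ≠ 0 := by simpa using hden 0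
  have hden1 : 1 - qpow q μ0 / q * (s / x) ≠ 0 := by
    simpa [← sub_eq_add_neg, qpow_sub hq0, qpow_one] using hden (-1)
  set G := qPochInf q (q * (qpow q μ * (s / x))) / qPochInf q (q * (qpow q μ0 * (s / x))) with hG
  have hF (c : ℝ) : qPochInf q (qpow q c * (s / x))
      = (1 - qpow q c * (s / x)) * qPochInf q (q * (qpow q c * (s / x))) :=
    qPochInf_eq_one_sub_mul hq0 hq1 _
  have hF' (c : ℝ) : qPochInf q (qpow q c / q * (s / x))
      = (1 - qpow q c / q * (s / x)) * qPochInf q (qpow q c * (s / x)) := by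
    rw [qPochInf_eq_one_sub_mul hq0 hq1]
    congr 2
    field_simp
  have hP : P1 q μ μ0 x s = (1 - qpow q μ * (s / x)) / (1 - qpow q μ0 * (s / x)) * G := by
    rw [P1, mul_div_assoc, mul_div_assoc, hF, hF, hG, mul_div_mul_comm]
  have hPdown : qPochInf q (qpow q μ / q * (s / x)) / qPochInf q (qpow q μ0 / q * (s / x))
      = (1 - qpow q μ / q * (s / x)) / (1 - qpow q μ0 / q * (s / x)) *
        ((1 - qpow q μ * (s / x)) / (1 - qpow q μ0 * (s / x)) * G) := by
    simp only [hF', hF, hG, mul_div_mul_comm]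
  have hPxdiv : P1 q μ μ0 (x / q) s = G := by
    rw [hG, P1]
    congr 2 <;> field_simp
  have hPsmul : P1 q μ μ0 x (q * s) = G := by
    rw [hG, P1]
    congr 2 <;> field_simp
  have hPxmul : P1 q μ μ0 (q * x) s = (1 - qpow q μ / q * (s / x)) /
      (1 - qpow q μ0 / q * (s / x)) * ((1 - qpow q μ * (s / x)) / (1 - qpow q μ0 * (s / x)) * G) := by
    rw [← hPdown, P1]
    congr 2 <;> field_simp
  have hPsdiv : P1 q μ μ0 x (s / q) = (1 - qpow q μ / q * (s / x)) /
      (1 - qpow q μ0 / q * (s / x)) * ((1 - qpow q μ * (s / x)) / (1 - qpow q μ0 * (s / x)) * G) := by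
    rw [← hPdown, P1]
    congr 2 <;> field_simp
  clear_value G
  have hcoef : qpow q ((h1 + h2 + l1 + l2 + a1 + a2) / 2) * (qpow q (b / 2) + qpow q (-(b / 2)))
      = qpow q (tl1 + tl2 + μ0 + μ0 + χ + a1) + qpow q (th1 + th2 + μ0 + μ0 + a1 + ta1 - ta2) := by
    rw [mul_add, ← qpow_add hq0, ← qpow_add hq0]
    subst hb ha2 hl1 hl2 hh1 hh2
    congr 2 <;> rw [hχ] <;> ring
  have htcoef : qpow q ((th1 + th2 + tl1 + tl2 + ta1 + ta2) / 2) *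
      (qpow q (tb / 2) + qpow q (-(tb / 2)))
      = qpow q (th1 + th2 + ta1 - χ) + qpow q (tl1 + tl2 + ta2 + χ) := by
    rw [mul_add, ← qpow_add hq0, ← qpow_add hq0]
    congr 2 <;> rw [hχ] <;> ring
  unfold A4
  simp only [hΦ, hcoef, htcoef, hP, hPxdiv, hPsmul, hPxmul, hPsdiv, mul_cpow_qpow hq0 hx,
    mul_cpow_qpow hq0 hs, div_cpow_qpow hq0 hx, div_cpow_qpow hq0 hs]
  clear hcoef htcoef hP hPxdiv hPsmul hPxmul hPsdiv hPdown hF hF' hden hres hΦ hχ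
  subst hν hμ hb ha2 hl1 hl2 hh1 hh2
  simp only [qpow_add hq0, qpow_sub hq0, qpow_neg, qpow_one]
  have hR := qpow_half_sq hq0
  have hM := qpow_ne_zero hq0 μ0
  have hX := qpow_ne_zero hq0 χ
  have hA := qpow_ne_zero hq0 a1
  have hU1 := qpow_ne_zero hq0 ta1
  have hU2 := qpow_ne_zero hq0 ta2
  have hR0 := qpow_ne_zero hq0 (1 / 2)
  simp only [← hR] at hden1 ⊢
  generalize qpow q (1 / 2) = R at *
  generalize qpow q μ0 = M at *
  generalize qpow q χ = X at *
  generalize qpow q a1 = A at *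
  generalize qpow q ta1 = U1 at *
  generalize qpow q ta2 = U2 at *
  generalize qpow q th1 = H1 at *
  generalize qpow q th2 = H2 at *
  generalize qpow q tl1 = L1 at *
  generalize qpow q tl2 = L2 at *
  generalize x ^ ((-a1 : ℝ) : ℂ) = xa at *
  generalize s ^ ((1 + χ - ta1 : ℝ) : ℂ) = sa at *
  have hd0 : x - M * s ≠ 0 := by
    contrapose! hden0
    field_simp
    simpa using hden0
  have hd1 : x * R ^ 2 - M * s ≠ 0 := by
    contrapose! hden1
    field_simp
    simpa [mul_comm x] using hden1
  field_simp
  ring
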